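/- Suppose there is a type of 'things' with a unary predicate C, a binary predicate O, a binary predicate A (read: A(x,z) means 'z is an arrow of x'), and a unary operation sending each thing w to its identity arrow 1_w. Suppose a thing R satisfies the full Axiom 2: C holds of R; for every thing y, O(R,y) holds if and only if (C holds of y and for all u, O(y,u) implies y ≠ u); and for every thing z, A(R,z) holds if and only if there exists v with O(R,v) and z = 1_v. Then a contradiction follows (False is derivable). -/

import Mathlib

theorem stmt_5 {Thing : Type*} (C : Thing → Prop) (O : Thing → Thing → Prop)
    (A : Thing → Thing → Prop) (idArrow : Thing → Thing)
    (R : Thing) (hC : C R)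
    (hO : ∀ y, O R y ↔ (C y ∧ ∀ u, O y u → y ≠ u))
    (hA : ∀ z, A R z ↔ ∃ v, O R v ∧ z = idArrow v) :
    False := by
  have hR : ¬ O R R := fun h => ((hO R).1 h).2 R h rfl
  exact hR ((hO R).2 ⟨hC, fun u hu hRu => hR (hRu ▸ hu)⟩)
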